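/- arXiv:1308.3871 — 9 statements merged into one kernel-verified Lean document; each statement's English description precedes it below -/
import Mathlib

section
/- Let V be a finite-dimensional irreducible complex representation of G. Then every conjugate-linear σ_G-equivariant map f : V → V satisfies f ∘ f = k • id_V for some real number k. -/
/-- Let `σG` be an involutive automorphism of a group `G` and `V` a
finite-dimensional irreducible complex representation of `G`.  Then every conjugate-linear
`σG`-equivariant map `f : V → V` satisfies `f ∘ f = k • id` for some real number `k`. -/
theorem conjLinear_equivariant_sq_eq_real_smul_id
    {G : Type*} [Group G] (σG : G →* G) (hσ : ∀ g, σG (σG g) = g)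
    {V : Type*} [AddCommGroup V] [Module ℂ V] [FiniteDimensional ℂ V]
    (ρ : Representation ℂ G V)
    (hV : ∃ v : V, v ≠ 0)
    (hirr : ∀ W : Submodule ℂ V, (∀ (g : G), ∀ v ∈ W, ρ g v ∈ W) → W = ⊥ ∨ W = ⊤)
    (f : V → V)
    (hadd : ∀ u v : V, f (u + v) = f u + f v)
    (hconj : ∀ (c : ℂ) (v : V), f (c • v) = (starRingEnd ℂ) c • f v)
    (hequiv : ∀ (g : G) (v : V), f (ρ g v) = ρ (σG g) (f v)) :
    ∃ k : ℝ, ∀ v : V, f (f v) = (k : ℂ) • v := by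
  obtain ⟨v0, hv0⟩ := hV
  haveI : Nontrivial V := ⟨v0, 0, hv0⟩
  let T : V →ₗ[ℂ] V :=
    { toFun := fun v => f (f v)
      map_add' := fun u v => by simp only [hadd]
      map_smul' := fun c v => by simp [hconj] }
  have hT : ∀ v, T v = f (f v) := fun v => rfl
  obtain ⟨μ, hμ⟩ := Module.End.exists_eigenvalue T
  have htop : Module.End.eigenspace T μ = ⊤ := by
    refine (hirr _ ?_).resolve_left hμ
    intro g v hv
    rw [Module.End.mem_eigenspace_iff, hT] at hv ⊢
    rw [hequiv, hequiv, hσ, hv, map_smul]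
  have hff : ∀ v, f (f v) = μ • v := by
    intro v
    have h : v ∈ Module.End.eigenspace T μ := by rw [htop]; trivial
    rwa [Module.End.mem_eigenspace_iff] at h
  by_cases hf : ∀ v, f v = 0
  · exact ⟨0, fun v => by simp [hf]⟩
  · obtain ⟨w, hw⟩ := not_forall.mp hf
    have h1 : (starRingEnd ℂ) μ • f w = μ • f w := by
      rw [← hconj, ← hff w, hff (f w)]
    have h2 : (starRingEnd ℂ) μ = μ := smul_left_injective ℂ hw h1
    obtain ⟨k, hk⟩ := Complex.conj_eq_iff_real.mp h2
    exact ⟨k, fun v => by rw [← hk, hff]⟩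
end

section
/- Let V be a finite-dimensional irreducible complex representation of G, and suppose there exists a bijective conjugate-linear σ_G-equivariant map f : V → V. Then there exists a conjugate-linear σ_G-equivariant map g : V → V such that g ∘ g = id_V or g ∘ g = −id_V. -/
/-- Let `σG` be an involutive automorphism of a group `G` and `V` a
finite-dimensional irreducible complex representation of `G`.  If there exists a bijective
conjugate-linear `σG`-equivariant map `f : V → V`, then there exists a conjugate-linear
`σG`-equivariant map `g : V → V` with `g ∘ g = id` or `g ∘ g = -id`. -/
theorem exists_conjLinear_equivariant_sq_eq_id_or_neg_id
    {G : Type*} [Group G] (σG : G →* G) (hσ : ∀ g, σG (σG g) = g)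
    {V : Type*} [AddCommGroup V] [Module ℂ V] [FiniteDimensional ℂ V]
    (ρ : Representation ℂ G V)
    (hV : ∃ v : V, v ≠ 0)
    (hirr : ∀ W : Submodule ℂ V, (∀ (g : G), ∀ v ∈ W, ρ g v ∈ W) → W = ⊥ ∨ W = ⊤)
    (f : V → V) (hbij : Function.Bijective f)
    (hadd : ∀ u v : V, f (u + v) = f u + f v)
    (hconj : ∀ (c : ℂ) (v : V), f (c • v) = (starRingEnd ℂ) c • f v)
    (hequiv : ∀ (g : G) (v : V), f (ρ g v) = ρ (σG g) (f v)) :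
    ∃ g : V → V,
      (∀ u v : V, g (u + v) = g u + g v) ∧
      (∀ (c : ℂ) (v : V), g (c • v) = (starRingEnd ℂ) c • g v) ∧
      (∀ (g₀ : G) (v : V), g (ρ g₀ v) = ρ (σG g₀) (g v)) ∧
      ((∀ v : V, g (g v) = v) ∨ (∀ v : V, g (g v) = -v)) := by
  classical
  obtain ⟨v₀, hv₀⟩ := hV
  haveI : Nontrivial V := ⟨v₀, 0, hv₀⟩
  let T : Module.End ℂ V :=
    { toFun := fun v => f (f v)
      map_add' := fun u v => by rw [hadd, hadd]
      map_smul' := fun c v => by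
        rw [hconj, hconj, Complex.conj_conj]; rfl }
  have hT : ∀ v, T v = f (f v) := fun v => rfl
  obtain ⟨l, hl⟩ := Module.End.exists_eigenvalue T
  have hff : ∀ v, f (f v) = l • v := by
    rcases hirr (Module.End.eigenspace T l) (by
      intro g v hv
      rw [Module.End.mem_eigenspace_iff] at hv ⊢
      rw [hT] at hv ⊢
      rw [hequiv, hequiv, hσ, hv, map_smul]) with h | h
    · exact absurd h hl
    · intro v
      have hv : v ∈ Module.End.eigenspace T l := by rw [h]; trivial
      exact Module.End.mem_eigenspace_iff.mp hv
  have hf0 : f 0 = 0 := by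
    have := hconj 0 0
    simpa using this
  have hfv : f v₀ ≠ 0 := fun h => hv₀ (hbij.1 (h.trans hf0.symm))
  have hreal : (starRingEnd ℂ) l = l := by
    have h1 := hff (f v₀)
    rw [hff v₀, hconj] at h1
    exact smul_left_injective ℂ hfv h1
  have hl0 : l ≠ 0 := by
    rintro rfl
    have h1 := hff v₀
    rw [zero_smul] at h1
    exact hfv (hbij.1 (h1.trans hf0.symm))
  obtain ⟨r, rfl⟩ := Complex.conj_eq_iff_real.mp hreal
  have hr0 : r ≠ 0 := by
    rintro rfl
    exact hl0 Complex.ofReal_zero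
  let s : ℝ := (Real.sqrt |r|)⁻¹
  have hs : s * s = |r|⁻¹ := by
    rw [← mul_inv, Real.mul_self_sqrt (abs_nonneg r)]
  have hgg : ∀ v, (s : ℂ) • f ((s : ℂ) • f v) = ((|r|⁻¹ * r : ℝ) : ℂ) • v := by
    intro v
    rw [hconj, hff, Complex.conj_ofReal, smul_smul, smul_smul, ← hs]
    push_cast
    rfl
  refine ⟨fun v => (s : ℂ) • f v, ?_, ?_, ?_, ?_⟩
  · intro u v
    simp only [hadd, smul_add]
  · intro c v
    simp only [hconj]
    rw [smul_comm]
  · intro g v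
    simp only [hequiv, map_smul]
  · rcases lt_or_gt_of_ne hr0 with h | h
    · right
      intro v
      have h1 : |r|⁻¹ * r = -1 := by
        rw [abs_of_neg h]; field_simp
      have := hgg v
      rw [h1] at this
      simpa using this
    · left
      intro v
      have h1 : |r|⁻¹ * r = 1 := by
        rw [abs_of_pos h]; field_simp
      have := hgg v
      rw [h1] at this
      simpa using this
end

section
/- Let (V, ρ) be a complex representation of G with a Real structure σ_V, and define F : V × V → V × V by F(u, w) = (u + σ_V(w), i • (u − σ_V(w))). Then: (a) F is an additive bijection; (b) F(c • u, conj(c) • w) = c • F(u, w) for all c ∈ ℂ and u, w ∈ V; (c) F(ρ(g) u, ρ(σ_G(g)) w) = (ρ(g) × ρ(g)) (F(u, w)) for all g ∈ G and u, w ∈ V; (d) F(w, u) = (σ_V × σ_V)(F(u, w)) for all u, w ∈ V. (Thus F realizes an isomorphism of Real G-representations between V ⊕ σ_G^*(conjugate of V) equipped with the swap Real structure and the direct sum (V, σ_V) ⊕ (V, σ_V).) -/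
/-- Let `(V, ρ)` be a complex representation of `G` with a Real structure
`σV` (a conjugate-linear `σG`-equivariant involution), and define
`F (u, w) = (u + σV w, i • (u - σV w))`.  Then `F` is an additive bijection, satisfies
`F (c • u, conj c • w) = c • F (u, w)`, intertwines the action `(u, w) ↦ (ρ g u, ρ (σG g) w)`
with the diagonal action `ρ g × ρ g`, and intertwines the swap `(u, w) ↦ (w, u)` with
`σV × σV`.  (Thus `V ⊕ σG^* V̄` with the swap Real structure is isomorphic to
`(V, σV) ⊕ (V, σV)` as Real `G`-representations.) -/
theorem realStructure_doubling_iso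
    {G : Type*} [Group G] (σG : G →* G) (hσ : ∀ g, σG (σG g) = g)
    {V : Type*} [AddCommGroup V] [Module ℂ V]
    (ρ : Representation ℂ G V)
    (σV : V → V)
    (hadd : ∀ u v : V, σV (u + v) = σV u + σV v)
    (hconj : ∀ (c : ℂ) (v : V), σV (c • v) = (starRingEnd ℂ) c • σV v)
    (hequiv : ∀ (g : G) (v : V), σV (ρ g v) = ρ (σG g) (σV v))
    (hinv : ∀ v : V, σV (σV v) = v)
    (F : V × V → V × V)
    (hF : ∀ u w : V, F (u, w) = (u + σV w, Complex.I • (u - σV w))) :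
    Function.Bijective F ∧
    (∀ p q : V × V, F (p + q) = F p + F q) ∧
    (∀ (c : ℂ) (u w : V), F (c • u, (starRingEnd ℂ) c • w) = c • F (u, w)) ∧
    (∀ (g : G) (u w : V), F (ρ g u, ρ (σG g) w) = (ρ g (F (u, w)).1, ρ g (F (u, w)).2)) ∧
    (∀ u w : V, F (w, u) = (σV (F (u, w)).1, σV (F (u, w)).2)) := by
  have hneg : ∀ v : V, σV (-v) = -σV v := by
    intro v
    have h := hconj (-1) v
    simpa using h
  have hsub : ∀ u v : V, σV (u - v) = σV u - σV v := by
    intro u v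
    rw [sub_eq_add_neg, hadd, hneg, ← sub_eq_add_neg]
  have hI : Complex.I * Complex.I = -1 := Complex.I_mul_I
  refine ⟨⟨?_, ?_⟩, ?_, ?_, ?_, ?_⟩
  · rintro ⟨u, w⟩ ⟨u', w'⟩ h
    rw [hF, hF, Prod.mk.injEq] at h
    obtain ⟨h1, h2⟩ := h
    have h3 : u - σV w = u' - σV w' := smul_right_injective V Complex.I_ne_zero h2
    have h4 : (2 : ℂ) • u = (2 : ℂ) • u' := by
      calc (2 : ℂ) • u = (u + σV w) + (u - σV w) := by module
        _ = (u' + σV w') + (u' - σV w') := by rw [h1, h3]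
        _ = (2 : ℂ) • u' := by module
    have h5 : u = u' := smul_right_injective V (two_ne_zero : (2 : ℂ) ≠ 0) h4
    subst h5
    have h6 : σV w = σV w' := add_left_cancel h1
    have h7 : w = w' := by rw [← hinv w, h6, hinv]
    rw [h7]
  · rintro ⟨a, b⟩
    refine ⟨((2⁻¹ : ℂ) • (a - Complex.I • b), σV ((2⁻¹ : ℂ) • (a + Complex.I • b))), ?_⟩
    rw [hF, hinv, Prod.mk.injEq]
    constructor
    · module
    · have : (2⁻¹ : ℂ) • (a - Complex.I • b) - (2⁻¹ : ℂ) • (a + Complex.I • b)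
          = -(Complex.I • b) := by module
      rw [this, smul_neg, smul_smul, hI]
      simp
  · rintro ⟨u, w⟩ ⟨u', w'⟩
    rw [Prod.mk_add_mk, hF, hF, hF, hadd, Prod.mk_add_mk, Prod.mk.injEq]
    constructor <;> module
  · intro c u w
    rw [hF, hF, hconj, Complex.conj_conj, Prod.smul_mk, Prod.mk.injEq]
    constructor <;> module
  · intro g u w
    rw [hF, hF, hequiv, hσ]
    simp
  · intro u w
    rw [hF, hF]
    simp only [hadd, hconj, hsub, hinv, Complex.conj_I, Prod.mk.injEq]
    constructor <;> module
end

section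
/- Let (V, ρ) be a complex representation of G with a Quaternionic structure J, and define F : V × V → V × V by F(u, w) = (u + J(w), i • (u − J(w))). Then: (a) F is an additive bijection; (b) F(c • u, conj(c) • w) = c • F(u, w) for all c ∈ ℂ and u, w ∈ V; (c) F(ρ(g) u, ρ(σ_G(g)) w) = (ρ(g) × ρ(g)) (F(u, w)) for all g ∈ G and u, w ∈ V; (d) F(−w, u) = (J × J)(F(u, w)) for all u, w ∈ V. (Thus F realizes an isomorphism of Quaternionic G-representations between V ⊕ σ_G^*(conjugate of V) equipped with the twisted-swap Quaternionic structure (u, w) ↦ (−w, u) and the direct sum (V, J) ⊕ (V, J).) -/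
/-- Let `(V, ρ)` be a complex representation of `G` with a Quaternionic
structure `J` (a conjugate-linear `σG`-equivariant map with `J ∘ J = -id`), and define
`F (u, w) = (u + J w, i • (u - J w))`.  Then `F` is an additive bijection, satisfies
`F (c • u, conj c • w) = c • F (u, w)`, intertwines the action `(u, w) ↦ (ρ g u, ρ (σG g) w)`
with the diagonal action `ρ g × ρ g`, and intertwines the twisted swap `(u, w) ↦ (-w, u)`
with `J × J`.  (Thus `V ⊕ σG^* V̄` with the twisted-swap Quaternionic structure is
isomorphic to `(V, J) ⊕ (V, J)` as Quaternionic `G`-representations.) -/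
theorem quaternionicStructure_doubling_iso
    {G : Type*} [Group G] (σG : G →* G) (hσ : ∀ g, σG (σG g) = g)
    {V : Type*} [AddCommGroup V] [Module ℂ V]
    (ρ : Representation ℂ G V)
    (J : V → V)
    (hadd : ∀ u v : V, J (u + v) = J u + J v)
    (hconj : ∀ (c : ℂ) (v : V), J (c • v) = (starRingEnd ℂ) c • J v)
    (hequiv : ∀ (g : G) (v : V), J (ρ g v) = ρ (σG g) (J v))
    (hsq : ∀ v : V, J (J v) = -v)
    (F : V × V → V × V)
    (hF : ∀ u w : V, F (u, w) = (u + J w, Complex.I • (u - J w))) :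
    Function.Bijective F ∧
    (∀ p q : V × V, F (p + q) = F p + F q) ∧
    (∀ (c : ℂ) (u w : V), F (c • u, (starRingEnd ℂ) c • w) = c • F (u, w)) ∧
    (∀ (g : G) (u w : V), F (ρ g u, ρ (σG g) w) = (ρ g (F (u, w)).1, ρ g (F (u, w)).2)) ∧
    (∀ u w : V, F (-w, u) = (J (F (u, w)).1, J (F (u, w)).2)) := by
  have hneg : ∀ v, J (-v) = -J v := by
    intro v
    have h := hconj (-1) v
    simpa using h
  have hsub : ∀ u v, J (u - v) = J u - J v := by
    intro u v
    rw [sub_eq_add_neg, hadd, hneg, ← sub_eq_add_neg]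
  have hII : ∀ v : V, Complex.I • Complex.I • v = -v := by
    intro v
    rw [smul_smul, Complex.I_mul_I, neg_one_smul]
  refine ⟨⟨?_, ?_⟩, ?_, ?_, ?_, ?_⟩
  · rintro ⟨u, w⟩ ⟨u', w'⟩ h
    rw [hF, hF, Prod.mk.injEq] at h
    obtain ⟨h1, h2⟩ := h
    have h3 : u - J w = u' - J w' := by
      have := congrArg (fun v => Complex.I • v) h2
      simp only [hII] at this
      exact neg_injective this
    have h4 : u = u' := by
      have h5 : (2 : ℂ) • u = (2 : ℂ) • u' := by
        rw [two_smul, two_smul]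
        calc u + u = (u + J w) + (u - J w) := by abel
          _ = (u' + J w') + (u' - J w') := by rw [h1, h3]
          _ = u' + u' := by abel
      have := congrArg (fun v => (2⁻¹ : ℂ) • v) h5
      simpa [smul_smul] using this
    subst h4
    have h6 : J w = J w' := add_left_cancel h1
    have h7 := congrArg J h6
    rw [hsq, hsq] at h7
    rw [neg_injective h7]
  · rintro ⟨a, b⟩
    refine ⟨((2⁻¹ : ℂ) • (a - Complex.I • b), -J ((2⁻¹ : ℂ) • (a + Complex.I • b))), ?_⟩
    rw [hF, hneg, hsq, neg_neg, Prod.mk.injEq]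
    constructor
    · module
    · have h : (2⁻¹ : ℂ) • (a - Complex.I • b) - (2⁻¹ : ℂ) • (a + Complex.I • b)
          = -(Complex.I • b) := by module
      rw [h, smul_neg, hII, neg_neg]
  · rintro ⟨u, w⟩ ⟨u', w'⟩
    rw [Prod.mk_add_mk, hF, hF, hF, hadd, Prod.mk_add_mk, Prod.mk.injEq]
    constructor <;> module
  · intro c u w
    rw [hF, hF, hconj, Complex.conj_conj, Prod.smul_mk, Prod.mk.injEq]
    constructor <;> module
  · intro g u w
    simp only [hF, hequiv, hσ, map_add, map_sub, map_smul]
  · intro u w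
    simp only [hF, hadd, hsub, hconj, hsq, Complex.conj_I, Prod.mk.injEq]
    constructor <;> module
end

section
/- Let V be a finite-dimensional irreducible complex representation of G and let s : V → V be a bijective conjugate-linear σ_G-equivariant map. If φ : V → V is a ℂ-linear map satisfying φ ∘ ρ(g) = ρ(g) ∘ φ for all g ∈ G and φ ∘ s = s ∘ φ, then there exists a real number r with φ = r • id_V. (In particular, the commuting field of a Real or Quaternionic representation whose underlying complex representation is irreducible is ℝ.) -/
/-- Let `V` be a finite-dimensional irreducible complex representation of
`G` and `s : V → V` a bijective conjugate-linear `σG`-equivariant map.  Then any `ℂ`-linear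
endomorphism `φ` of `V` commuting with all `ρ g` and with `s` is a real scalar multiple of
the identity.  (The commuting field of a Real or Quaternionic representation whose
underlying complex representation is irreducible is `ℝ`.) -/
theorem commutant_eq_real_smul_id
    {G : Type*} [Group G] (σG : G →* G) (hσ : ∀ g, σG (σG g) = g)
    {V : Type*} [AddCommGroup V] [Module ℂ V] [FiniteDimensional ℂ V]
    (ρ : Representation ℂ G V)
    (hV : ∃ v : V, v ≠ 0)
    (hirr : ∀ W : Submodule ℂ V, (∀ (g : G), ∀ v ∈ W, ρ g v ∈ W) → W = ⊥ ∨ W = ⊤)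
    (s : V → V) (hbij : Function.Bijective s)
    (hadds : ∀ u v : V, s (u + v) = s u + s v)
    (hconjs : ∀ (c : ℂ) (v : V), s (c • v) = (starRingEnd ℂ) c • s v)
    (hequivs : ∀ (g : G) (v : V), s (ρ g v) = ρ (σG g) (s v))
    (φ : V →ₗ[ℂ] V)
    (hφρ : ∀ (g : G) (v : V), φ (ρ g v) = ρ g (φ v))
    (hφs : ∀ v : V, φ (s v) = s (φ v)) :
    ∃ r : ℝ, ∀ v : V, φ v = (r : ℂ) • v := by
  obtain ⟨v₀, hv₀⟩ := hV
  haveI : Nontrivial V := ⟨⟨v₀, 0, hv₀⟩⟩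
  obtain ⟨c, hc⟩ := Module.End.exists_eigenvalue φ
  have htop : Module.End.eigenspace φ c = ⊤ := by
    rcases hirr (Module.End.eigenspace φ c) (by
      intro g v hv
      rw [Module.End.mem_eigenspace_iff] at hv ⊢
      rw [hφρ, hv, map_smul]) with h | h
    · exact absurd h hc
    · exact h
  have hall : ∀ v, φ v = c • v := fun v =>
    Module.End.mem_eigenspace_iff.mp (htop ▸ Submodule.mem_top)
  obtain ⟨w, rfl⟩ := hbij.2 v₀
  have h1 : c • s w = (starRingEnd ℂ) c • s w := by
    rw [← hall, hφs, hall, hconjs]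
  have h2 : c = (starRingEnd ℂ) c := smul_left_injective ℂ hv₀ h1
  obtain ⟨r, hr⟩ := Complex.conj_eq_iff_real.mp h2.symm
  exact ⟨r, fun v => by rw [hall, hr]⟩
end

section
/- Let V be a finite-dimensional irreducible complex representation of G equipped with a G-invariant Hermitian inner product. Then the following are equivalent: (i) there exists a conjugate-linear σ_G-equivariant map f : V → V with f ∘ f = id_V; (ii) there exists a nondegenerate symmetric ℂ-bilinear form B : V × V → ℂ such that B(ρ(g) v, ρ(σ_G(g)) w) = B(v, w) for all g ∈ G and v, w ∈ V. (This characterizes the irreducible complex representations of real type with respect to σ_G.) -/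
/-- Let `V` be a finite-dimensional irreducible complex representation of
`G` equipped with a `G`-invariant Hermitian inner product.  Then there exists a
conjugate-linear `σG`-equivariant map `f : V → V` with `f ∘ f = id` if and only if there
exists a nondegenerate symmetric `ℂ`-bilinear form `B` on `V` with
`B (ρ g v) (ρ (σG g) w) = B v w` for all `g, v, w`.  (This characterizes the irreducible
representations of real type with respect to `σG`.) -/
theorem realType_iff_exists_symmetric_invariant_form
    {G : Type*} [Group G] (σG : G →* G) (hσ : ∀ g, σG (σG g) = g)
    {V : Type*} [AddCommGroup V] [Module ℂ V] [FiniteDimensional ℂ V]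
    (ρ : Representation ℂ G V)
    (hV : ∃ v : V, v ≠ 0)
    (hirr : ∀ W : Submodule ℂ V, (∀ (g : G), ∀ v ∈ W, ρ g v ∈ W) → W = ⊥ ∨ W = ⊤)
    (inner : V → V → ℂ)
    (hadd₁ : ∀ u v w : V, inner (u + v) w = inner u w + inner v w)
    (hsmul₁ : ∀ (c : ℂ) (u w : V), inner (c • u) w = c * inner u w)
    (hherm : ∀ u w : V, inner w u = (starRingEnd ℂ) (inner u w))
    (hpos : ∀ v : V, v ≠ 0 → 0 < (inner v v).re)
    (hGinv : ∀ (g : G) (u w : V), inner (ρ g u) (ρ g w) = inner u w) :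
    (∃ f : V → V,
       (∀ u v : V, f (u + v) = f u + f v) ∧
       (∀ (c : ℂ) (v : V), f (c • v) = (starRingEnd ℂ) c • f v) ∧
       (∀ (g : G) (v : V), f (ρ g v) = ρ (σG g) (f v)) ∧
       (∀ v : V, f (f v) = v)) ↔
    (∃ B : V →ₗ[ℂ] V →ₗ[ℂ] ℂ,
       (∀ v w : V, B v w = B w v) ∧
       (∀ v : V, (∀ w : V, B v w = 0) → v = 0) ∧
       (∀ w : V, (∀ v : V, B v w = 0) → w = 0) ∧
       (∀ (g : G) (v w : V), B (ρ g v) (ρ (σG g) w) = B v w)) := by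
  classical
  have hadd₂ : ∀ u v w : V, inner w (u + v) = inner w u + inner w v := by
    intro u v w
    rw [hherm (u + v) w, hadd₁, map_add, ← hherm, ← hherm]
  have hsmul₂ : ∀ (c : ℂ) (u w : V), inner w (c • u) = (starRingEnd ℂ) c * inner w u := by
    intro c u w
    rw [hherm (c • u) w, hsmul₁, map_mul, ← hherm]
  have hinvr : ∀ (g : G) (v : V), ρ g (ρ g⁻¹ v) = v := by
    intro g v
    rw [← Module.End.mul_apply, ← map_mul]; simp
  constructor
  · rintro ⟨f, fadd, fsmul, feq, finv⟩
    have hfix : ∃ v : V, v ≠ 0 ∧ f v = v := by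
      by_contra! hcon
      obtain ⟨u, hu⟩ := hV
      have key : ∀ u : V, u + f u = 0 := by
        intro u
        by_contra hne
        apply hcon _ hne
        rw [fadd, finv, add_comm]
      have h1 := key u
      have h2 := key (Complex.I • u)
      rw [fsmul, eq_neg_of_add_eq_zero_right h1] at h2
      have h3 : ((2 : ℂ) * Complex.I) • u = 0 := by
        rw [← h2, Complex.conj_I]; module
      rcases smul_eq_zero.1 h3 with h | h
      · simp at h
      · exact hu h
    let B : V →ₗ[ℂ] V →ₗ[ℂ] ℂ := LinearMap.mk₂ ℂ (fun v w => inner v (f w) + inner w (f v))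
      (by intro a b c; simp only [fadd, hadd₁, hadd₂]; ring)
      (by intro c a b; simp only [fsmul, hsmul₁, hsmul₂, smul_eq_mul, Complex.conj_conj]; ring)
      (by intro a b c; simp only [fadd, hadd₁, hadd₂]; ring)
      (by intro c a b; simp only [fsmul, hsmul₁, hsmul₂, smul_eq_mul, Complex.conj_conj]; ring)
    have hB : ∀ v w, B v w = inner v (f w) + inner w (f v) := fun v w => rfl
    have hsym : ∀ v w, B v w = B w v := by
      intro v w; rw [hB, hB, add_comm]
    have hBinv : ∀ (g : G) (v w : V), B (ρ g v) (ρ (σG g) w) = B v w := by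
      intro g v w
      rw [hB, hB, feq, feq, hσ, hGinv, hGinv]
    have hnd : ∀ v : V, (∀ w : V, B v w = 0) → v = 0 := by
      have hk := hirr (LinearMap.ker B) (by
        intro g v hv
        rw [LinearMap.mem_ker] at hv ⊢
        ext w
        rw [← hinvr (σG g) w, hBinv, hv]; rfl)
      rcases hk with hk | hk
      · intro v hv
        have : v ∈ LinearMap.ker B := by
          rw [LinearMap.mem_ker]; ext w; exact hv w
        rw [hk] at this
        simpa using this
      · exfalso
        obtain ⟨v, hv, hfv⟩ := hfix
        have h1 : v ∈ LinearMap.ker B := by rw [hk]; trivial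
        rw [LinearMap.mem_ker] at h1
        have h2 : B v v = 0 := by rw [h1]; rfl
        rw [hB, hfv] at h2
        have h3 := congrArg Complex.re h2
        have := hpos v hv
        simp at h3
        linarith
    refine ⟨B, hsym, hnd, ?_, hBinv⟩
    intro w hw
    exact hnd w (fun v => by rw [hsym]; exact hw v)
  · rintro ⟨B, hsym, hnd, -, hBinv⟩
    have hinj : Function.Injective B := by
      rw [← LinearMap.ker_eq_bot, LinearMap.ker_eq_bot']
      intro v hv
      exact hnd v (fun w => by rw [hv]; rfl)
    have hsurj : Function.Surjective B :=
      (LinearMap.injective_iff_surjective_of_finrank_eq_finrank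
        (Subspace.dual_finrank_eq (K := ℂ) (V := V)).symm).1 hinj
    have hex : ∀ w : V, ∃ u : V, ∀ v, B v u = inner v w := by
      intro w
      obtain ⟨u, hu⟩ := hsurj
        { toFun := fun v => inner v w
          map_add' := fun a b => hadd₁ a b w
          map_smul' := fun c a => hsmul₁ c a w }
      refine ⟨u, fun v => ?_⟩
      rw [hsym, hu]; rfl
    choose k hk using hex
    have hext : ∀ a b : V, (∀ v, B v a = B v b) → a = b := by
      intro a b h
      apply hinj
      ext v
      rw [hsym a, hsym b, h]
    have kadd : ∀ u v, k (u + v) = k u + k v := by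
      intro u v; apply hext; intro x
      rw [map_add, hk, hk, hk, hadd₂]
    have ksmul : ∀ (c : ℂ) (v : V), k (c • v) = (starRingEnd ℂ) c • k v := by
      intro c v; apply hext; intro x
      rw [map_smul, hk, hk, hsmul₂, smul_eq_mul]
    have keq : ∀ (g : G) (v : V), k (ρ g v) = ρ (σG g) (k v) := by
      intro g v; apply hext; intro x
      rw [← hinvr g x, hk, hGinv, hBinv, hk]
    have kne : ∀ v, v ≠ 0 → k v ≠ 0 := by
      intro v hv h0
      have h := hk v v
      rw [h0, map_zero] at h
      have := hpos v hv
      rw [← h] at this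
      simp at this
    let K : V →ₗ[ℂ] V :=
      { toFun := fun v => k (k v)
        map_add' := fun a b => by rw [kadd, kadd]
        map_smul' := fun c a => by rw [ksmul, ksmul, Complex.conj_conj]; rfl }
    have hK : ∀ v, K v = k (k v) := fun v => rfl
    obtain ⟨v0, hv0⟩ := hV
    have : Nontrivial V := ⟨⟨v0, 0, hv0⟩⟩
    obtain ⟨l, hl⟩ := Module.End.exists_eigenvalue K
    have hKl : ∀ v, k (k v) = l • v := by
      have h := hirr (Module.End.eigenspace K l) (by
        intro g v hv
        rw [Module.End.mem_eigenspace_iff] at hv ⊢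
        rw [hK, keq, keq, hσ, ← hK, hv, map_smul])
      rcases h with h | h
      · exact absurd h hl
      · intro v
        have : v ∈ Module.End.eigenspace K l := by rw [h]; trivial
        rw [Module.End.mem_eigenspace_iff] at this
        exact this
    have hreal : ∀ v, (inner v v).im = 0 := by
      intro v
      exact Complex.conj_eq_iff_im.1 (hherm v v).symm
    have hl1 : inner (k v0) (k v0) = l * inner v0 v0 := by
      rw [← hk, hsym, hk, hKl, hsmul₁]
    have hp0 := hpos v0 hv0
    have hp1 := hpos _ (kne v0 hv0)
    have hlim : l.im = 0 := by
      have h := congrArg Complex.im hl1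
      rw [Complex.mul_im, hreal, hreal] at h
      have : l.im * (inner v0 v0).re = 0 := by linarith
      rcases mul_eq_zero.1 this with h | h
      · exact h
      · exact absurd h hp0.ne'
    have hlre : 0 < l.re := by
      have h := congrArg Complex.re hl1
      rw [Complex.mul_re, hreal] at h
      have h' : 0 < l.re * (inner v0 v0).re := by linarith
      exact (pos_iff_pos_of_mul_pos h').2 hp0
    have hll : l = ((l.re : ℝ) : ℂ) := by
      apply Complex.ext <;> simp [hlim]
    let s : ℝ := (Real.sqrt l.re)⁻¹
    have hs : ((s : ℂ) * (s : ℂ)) * l = 1 := by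
      rw [hll, ← Complex.ofReal_mul, ← Complex.ofReal_mul]
      norm_cast
      have h1 : Real.sqrt l.re * Real.sqrt l.re = l.re := Real.mul_self_sqrt hlre.le
      have h2 : s * s = l.re⁻¹ := by
        simp only [s]; rw [← mul_inv, h1]
      rw [h2, inv_mul_cancel₀ hlre.ne']
    refine ⟨fun v => (s : ℂ) • k v, ?_, ?_, ?_, ?_⟩
    · intro u v
      simp only [kadd, smul_add]
    · intro c v
      simp only [ksmul]
      rw [smul_comm]
    · intro g v
      simp only [keq, map_smul]
    · intro v
      simp only [ksmul, hKl, Complex.conj_ofReal, smul_smul]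
      rw [← mul_assoc, hs, one_smul]
end

section
/- Let V be a finite-dimensional irreducible complex representation of G equipped with a G-invariant Hermitian inner product. Then the following are equivalent: (i) there exists a conjugate-linear σ_G-equivariant map f : V → V with f ∘ f = −id_V; (ii) there exists a nondegenerate skew-symmetric ℂ-bilinear form B : V × V → ℂ (B(v, w) = −B(w, v)) such that B(ρ(g) v, ρ(σ_G(g)) w) = B(v, w) for all g ∈ G and v, w ∈ V. (This characterizes the irreducible complex representations of quaternionic type with respect to σ_G.) -/
/-- Let `V` be a finite-dimensional irreducible complex representation of
`G` equipped with a `G`-invariant Hermitian inner product.  Then there exists a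
conjugate-linear `σG`-equivariant map `f : V → V` with `f ∘ f = -id` if and only if there
exists a nondegenerate skew-symmetric `ℂ`-bilinear form `B` on `V` with
`B (ρ g v) (ρ (σG g) w) = B v w` for all `g, v, w`.  (This characterizes the irreducible
representations of quaternionic type with respect to `σG`.) -/
theorem quaternionicType_iff_exists_skewSymmetric_invariant_form
    {G : Type*} [Group G] (σG : G →* G) (hσ : ∀ g, σG (σG g) = g)
    {V : Type*} [AddCommGroup V] [Module ℂ V] [FiniteDimensional ℂ V]
    (ρ : Representation ℂ G V)
    (hV : ∃ v : V, v ≠ 0)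
    (hirr : ∀ W : Submodule ℂ V, (∀ (g : G), ∀ v ∈ W, ρ g v ∈ W) → W = ⊥ ∨ W = ⊤)
    (inner : V → V → ℂ)
    (hadd₁ : ∀ u v w : V, inner (u + v) w = inner u w + inner v w)
    (hsmul₁ : ∀ (c : ℂ) (u w : V), inner (c • u) w = c * inner u w)
    (hherm : ∀ u w : V, inner w u = (starRingEnd ℂ) (inner u w))
    (hpos : ∀ v : V, v ≠ 0 → 0 < (inner v v).re)
    (hGinv : ∀ (g : G) (u w : V), inner (ρ g u) (ρ g w) = inner u w) :
    (∃ f : V → V,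
       (∀ u v : V, f (u + v) = f u + f v) ∧
       (∀ (c : ℂ) (v : V), f (c • v) = (starRingEnd ℂ) c • f v) ∧
       (∀ (g : G) (v : V), f (ρ g v) = ρ (σG g) (f v)) ∧
       (∀ v : V, f (f v) = -v)) ↔
    (∃ B : V →ₗ[ℂ] V →ₗ[ℂ] ℂ,
       (∀ v w : V, B v w = -B w v) ∧
       (∀ v : V, (∀ w : V, B v w = 0) → v = 0) ∧
       (∀ w : V, (∀ v : V, B v w = 0) → w = 0) ∧
       (∀ (g : G) (v w : V), B (ρ g v) (ρ (σG g) w) = B v w)) := by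
  have hadd₂ : ∀ u v w : V, inner u (v + w) = inner u v + inner u w := by
    intro u v w
    rw [hherm (v + w) u, hadd₁, map_add, ← hherm, ← hherm]
  have hsmul₂ : ∀ (c : ℂ) (u w : V), inner u (c • w) = (starRingEnd ℂ) c * inner u w := by
    intro c u w
    rw [hherm (c • w) u, hsmul₁, map_mul, ← hherm]
  have hneg₁ : ∀ u w : V, inner (-u) w = - inner u w := by
    intro u w
    have := hsmul₁ (-1) u w
    simpa using this
  have hneg₂ : ∀ u w : V, inner u (-w) = - inner u w := by
    intro u w
    have := hsmul₂ (-1) u w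
    simpa using this
  have hzero : ∀ v : V, inner v v = 0 → v = 0 := by
    intro v h
    by_contra hv
    have := hpos v hv
    rw [h] at this
    simp at this
  have hext : ∀ a b : V, (∀ v, inner v a = inner v b) → a = b := by
    intro a b h
    have h1 := hzero (a + -b) (by rw [hadd₂, hneg₂, h, add_neg_cancel])
    exact (add_neg_eq_zero.mp h1)
  constructor
  · rintro ⟨f, fadd, fsmul, fG, ff⟩
    have hskew : ∀ v w : V, inner v (f w) - inner w (f v)
        = -(inner w (f v) - inner v (f w)) := by intros; ring
    let B : V →ₗ[ℂ] V →ₗ[ℂ] ℂ := LinearMap.mk₂ ℂ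
      (fun v w => inner v (f w) - inner w (f v))
      (by intro a b c; simp only [hadd₁, fadd, hadd₂]; ring)
      (by intro a b c; simp only [hsmul₁, fsmul, hsmul₂, Complex.conj_conj, smul_eq_mul]; ring)
      (by intro a b c; simp only [hadd₁, fadd, hadd₂]; ring)
      (by intro a b c; simp only [hsmul₁, fsmul, hsmul₂, Complex.conj_conj, smul_eq_mul]; ring)
    have hB : ∀ v w, B v w = inner v (f w) - inner w (f v) := fun v w => rfl
    have nd : ∀ v : V, (∀ w : V, B v w = 0) → v = 0 := by
      intro v h
      by_contra hv
      have h1 := h (f v)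
      rw [hB, ff, hneg₂] at h1
      have h2 := hpos v hv
      have hfv : f v ≠ 0 := by
        intro h0
        have h3 := ff v
        rw [h0] at h3
        have h4 := fsmul 0 0
        simp at h4
        rw [h4] at h3
        exact hv (neg_eq_zero.mp h3.symm)
      have h5 := hpos _ hfv
      have h6 := congrArg Complex.re h1
      simp at h6
      linarith
    refine ⟨B, fun v w => by rw [hB, hB]; ring, nd, ?_, ?_⟩
    · intro w h
      refine nd w fun v => ?_
      have := h v
      rw [hB] at this ⊢
      linear_combination -this
    · intro g v w
      rw [hB, hB, fG, fG, hσ, hGinv, hGinv]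
  · rintro ⟨B, Bskew, nd, -, BG⟩
    let W : Submodule ℂ (Module.Dual ℂ V) :=
      { carrier := {φ | ∃ u, ∀ v, φ v = inner v u}
        add_mem' := by
          rintro a b ⟨u, hu⟩ ⟨w, hw⟩
          exact ⟨u + w, fun v => by rw [hadd₂, LinearMap.add_apply, hu, hw]⟩
        zero_mem' := ⟨0, fun v => by
          have := hsmul₂ 0 v 0
          simp at this
          simp [this]⟩
        smul_mem' := by
          rintro c a ⟨u, hu⟩
          exact ⟨(starRingEnd ℂ) c • u, fun v => by
            rw [hsmul₂, LinearMap.smul_apply, hu, Complex.conj_conj, smul_eq_mul]⟩ }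
    have hW : W.dualCoannihilator = ⊥ := by
      rw [eq_bot_iff]
      intro v hv
      rw [Submodule.mem_dualCoannihilator] at hv
      let φ : Module.Dual ℂ V :=
        { toFun := fun x => inner x v
          map_add' := fun a b => hadd₁ a b v
          map_smul' := fun c a => hsmul₁ c a v }
      exact hzero v (hv φ ⟨v, fun _ => rfl⟩)
    have hWtop : W = ⊤ := by
      rw [← Subspace.dualCoannihilator_dualAnnihilator_eq (W := W), hW,
        Submodule.dualAnnihilator_bot]
    have hex : ∀ w, ∃ u, ∀ v, B v w = inner v u := by
      intro w
      have : B.flip w ∈ W := by rw [hWtop]; trivial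
      exact this
    choose f hf using hex
    have fadd : ∀ u v : V, f (u + v) = f u + f v := by
      intro u v
      refine hext _ _ fun x => ?_
      rw [← hf, hadd₂, ← hf, ← hf, map_add]
    have fsmul : ∀ (c : ℂ) (v : V), f (c • v) = (starRingEnd ℂ) c • f v := by
      intro c v
      refine hext _ _ fun x => ?_
      rw [← hf, hsmul₂, ← hf, map_smul, Complex.conj_conj, smul_eq_mul]
    have fG : ∀ (g : G) (v : V), f (ρ g v) = ρ (σG g) (f v) := by
      intro g v
      refine hext _ _ fun x => ?_
      have hx : x = ρ (σG g) (ρ (σG g)⁻¹ x) := by simp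
      rw [← hf, hx, hGinv, ← hf]
      have := BG (σG g) (ρ (σG g)⁻¹ x) v
      rwa [hσ] at this
    let F : V →ₗ[ℂ] V :=
      { toFun := fun v => f (f v)
        map_add' := fun a b => by rw [fadd, fadd]
        map_smul' := fun c a => by rw [fsmul, fsmul, Complex.conj_conj, RingHom.id_apply] }
    have hF : ∀ v, F v = f (f v) := fun v => rfl
    obtain ⟨v₀, hv₀⟩ := hV
    haveI : Nontrivial V := ⟨v₀, 0, hv₀⟩
    obtain ⟨c, hc⟩ := Module.End.exists_eigenvalue F
    have hFc : ∀ v, f (f v) = c • v := by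
      rcases hirr (Module.End.eigenspace F c) (by
        intro g v hv
        rw [Module.End.mem_eigenspace_iff] at hv ⊢
        rw [hF, fG, fG, hσ, ← hF, hv, map_smul]) with h | h
      · exact absurd h hc
      · intro v
        have : v ∈ Module.End.eigenspace F c := by rw [h]; trivial
        rwa [Module.End.mem_eigenspace_iff] at this
    have hsk : ∀ v w, inner v (f w) = - inner w (f v) := by
      intro v w
      rw [← hf, ← hf, Bskew]
    have hfv : f v₀ ≠ 0 := by
      intro h0
      refine hv₀ (nd v₀ fun w => ?_)
      rw [Bskew, hf, h0]
      have := hsmul₂ 0 w 0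
      simp at this
      simp [this]
    have key : inner (f v₀) (f v₀) = - ((starRingEnd ℂ) c * inner v₀ v₀) := by
      rw [hsk, hFc, hsmul₂]
    have him : ∀ v, (inner v v).im = 0 := fun v =>
      Complex.conj_eq_iff_im.mp (hherm v v).symm
    have p1 := hpos _ hfv
    have p2 := hpos _ hv₀
    have kre := congrArg Complex.re key
    have kim := congrArg Complex.im key
    simp [him] at kre kim
    have hcim : c.im = 0 := by
      rcases kim with h | h
      · exact h
      · exact absurd h p2.ne'
    have hcre : c.re < 0 := by
      by_contra h
      push Not at h
      nlinarith [mul_nonneg h p2.le]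
    let r : ℝ := (Real.sqrt (-c.re))⁻¹
    have hr : r * r * c.re = -1 := by
      have h1 : Real.sqrt (-c.re) * Real.sqrt (-c.re) = -c.re := Real.mul_self_sqrt (by linarith)
      have h2 : r * r = (-c.re)⁻¹ := by
        rw [← h1, mul_inv]
      rw [h2, inv_neg, neg_mul, inv_mul_cancel₀ hcre.ne]
    have hrc : (r : ℂ) * ((r : ℂ) * c) = -1 := by
      have : c = (c.re : ℂ) := by apply Complex.ext <;> simp [hcim]
      rw [this, ← mul_assoc]
      exact_mod_cast hr
    refine ⟨fun v => (r : ℂ) • f v, ?_, ?_, ?_, ?_⟩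
    · intro u v
      simp only [fadd, smul_add]
    · intro a v
      simp only [fsmul]
      rw [smul_comm]
    · intro g v
      simp only [fG, map_smul]
    · intro v
      simp only [fsmul, hFc, Complex.conj_ofReal]
      rw [smul_smul, smul_smul, mul_assoc, hrc, neg_one_smul]
end

section
/- Let V be a finite-dimensional complex representation of G equipped with a G-invariant Hermitian inner product. Then the following are equivalent: (i) there exists a nondegenerate ℂ-bilinear form B : V × V → ℂ such that B(ρ(g) v, ρ(σ_G(g)) w) = B(v, w) for all g ∈ G and v, w ∈ V; (ii) there exists a bijective conjugate-linear σ_G-equivariant map c : V → V. (For irreducible V, condition (ii) says V is isomorphic to the conjugate of the σ_G-twist of V, so its failure characterizes the irreducible representations of complex type with respect to σ_G.) -/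
/-- Let `V` be a finite-dimensional complex representation of `G`
equipped with a `G`-invariant Hermitian inner product.  Then there exists a nondegenerate
`ℂ`-bilinear form `B` on `V` with `B (ρ g v) (ρ (σG g) w) = B v w` for all `g, v, w` if
and only if there exists a bijective conjugate-linear `σG`-equivariant map `c : V → V`
(i.e. `V` is isomorphic to the conjugate of its `σG`-twist). -/
theorem exists_invariant_form_iff_exists_conjLinear_equivariant_bijective
    {G : Type*} [Group G] (σG : G →* G) (hσ : ∀ g, σG (σG g) = g)
    {V : Type*} [AddCommGroup V] [Module ℂ V] [FiniteDimensional ℂ V]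
    (ρ : Representation ℂ G V)
    (inner : V → V → ℂ)
    (hadd₁ : ∀ u v w : V, inner (u + v) w = inner u w + inner v w)
    (hsmul₁ : ∀ (c : ℂ) (u w : V), inner (c • u) w = c * inner u w)
    (hherm : ∀ u w : V, inner w u = (starRingEnd ℂ) (inner u w))
    (hpos : ∀ v : V, v ≠ 0 → 0 < (inner v v).re)
    (hGinv : ∀ (g : G) (u w : V), inner (ρ g u) (ρ g w) = inner u w) :
    (∃ B : V →ₗ[ℂ] V →ₗ[ℂ] ℂ,
       (∀ v : V, (∀ w : V, B v w = 0) → v = 0) ∧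
       (∀ w : V, (∀ v : V, B v w = 0) → w = 0) ∧
       (∀ (g : G) (v w : V), B (ρ g v) (ρ (σG g) w) = B v w)) ↔
    (∃ c : V → V,
       Function.Bijective c ∧
       (∀ u v : V, c (u + v) = c u + c v) ∧
       (∀ (z : ℂ) (v : V), c (z • v) = (starRingEnd ℂ) z • c v) ∧
       (∀ (g : G) (v : V), c (ρ g v) = ρ (σG g) (c v))) := by
  have hadd₂ : ∀ u v w : V, inner u (v + w) = inner u v + inner u w := by
    intro u v w
    rw [hherm (v + w) u, hadd₁, map_add, ← hherm, ← hherm]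
  have hsmul₂ : ∀ (c : ℂ) (u w : V), inner u (c • w) = (starRingEnd ℂ) c * inner u w := by
    intro c u w
    rw [hherm (c • w) u, hsmul₁, map_mul, ← hherm]
  have hzero : ∀ u : V, inner u 0 = 0 := by
    intro u
    have := hsmul₂ 0 u 0
    simpa using this
  have hdef : ∀ v : V, inner v v = 0 → v = 0 := by
    intro v hv
    by_contra hne
    have := hpos v hne
    rw [hv] at this
    simp at this
  have hext : ∀ a b : V, (∀ w, inner w a = inner w b) → a = b := by
    intro a b h
    have h1 : inner (a - b) (a + (-1 : ℂ) • b) = 0 := by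
      rw [hadd₂, hsmul₂, h]; simp
    have h2 : a + (-1 : ℂ) • b = a - b := by simp [sub_eq_add_neg]
    rw [h2] at h1
    exact sub_eq_zero.mp (hdef _ h1)
  have hinv : ∀ (g : G) (w : V), ρ g (ρ g⁻¹ w) = w := by
    intro g w
    rw [← Module.End.mul_apply, ← map_mul]; simp
  let L : V →ₗ[ℝ] (V →ₗ[ℂ] ℂ) :=
    { toFun := fun u =>
        { toFun := fun w => inner w u
          map_add' := fun a b => hadd₁ a b u
          map_smul' := fun a b => by simp [hsmul₁] }
      map_add' := fun a b => by ext w; simp [hadd₂]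
      map_smul' := fun a b => by
        ext w
        have := hsmul₂ (a : ℂ) w b
        simpa using this }
  have hL : ∀ u w, L u w = inner w u := fun _ _ => rfl
  have hLinj : Function.Injective L := by
    intro a b h
    apply hext
    intro w
    rw [← hL, ← hL, h]
  haveI : FiniteDimensional ℝ V := FiniteDimensional.complexToReal V
  haveI : FiniteDimensional ℝ (V →ₗ[ℂ] ℂ) := FiniteDimensional.complexToReal _
  have hfr : Module.finrank ℝ V = Module.finrank ℝ (V →ₗ[ℂ] ℂ) := by
    rw [finrank_real_of_complex, finrank_real_of_complex]
    congr 1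
    exact (Subspace.dual_finrank_eq (K := ℂ) (V := V)).symm
  have hLsurj : Function.Surjective L :=
    (LinearMap.injective_iff_surjective_of_finrank_eq_finrank hfr).mp hLinj
  constructor
  · rintro ⟨B, hB1, hB2, hB3⟩
    choose c hc using fun v => hLsurj (B v)
    have hc' : ∀ v w, inner w (c v) = B v w := by
      intro v w
      rw [← hL, hc]
    have hBinj : Function.Injective B := by
      rw [← LinearMap.ker_eq_bot, LinearMap.ker_eq_bot']
      intro v hv
      exact hB1 v (fun w => by rw [hv]; rfl)
    have hBsurj : Function.Surjective B :=
      (LinearMap.injective_iff_surjective_of_finrank_eq_finrank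
        (Subspace.dual_finrank_eq (K := ℂ) (V := V)).symm).mp hBinj
    refine ⟨c, ⟨?_, ?_⟩, ?_, ?_, ?_⟩
    · intro a b h
      apply hBinj
      rw [← hc, ← hc, h]
    · intro u
      obtain ⟨v, hv⟩ := hBsurj (L u)
      exact ⟨v, hLinj (by rw [hc, hv])⟩
    · intro u v
      apply hext
      intro w
      simp [hadd₂, hc']
    · intro z v
      apply hext
      intro w
      simp [hsmul₂, hc']
    · intro g v
      apply hext
      intro w
      rw [hc']
      conv_lhs => rw [← hinv (σG g) w]
      conv_rhs => rw [← hinv (σG g) w]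
      rw [hB3, hGinv, hc']
  · rintro ⟨c, ⟨hinj, hsurj⟩, hca, hcs, hce⟩
    have hc0 : c 0 = 0 := by simpa using hcs 0 0
    refine ⟨LinearMap.mk₂ ℂ (fun v w => inner w (c v)) ?_ ?_ ?_ ?_, ?_, ?_, ?_⟩
    · intro a b w
      rw [hca, hadd₂]
    · intro z a w
      rw [hcs, hsmul₂]; simp
    · intro a v w
      rw [hadd₁]
    · intro z a w
      rw [hsmul₁]; simp
    · intro v hv
      apply hinj
      rw [hc0]
      exact hdef _ (by simpa using hv (c v))
    · intro w hw
      obtain ⟨v, rfl⟩ := hsurj w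
      exact hdef _ (by simpa using hw v)
    · intro g v w
      simp only [LinearMap.mk₂_apply]
      rw [hce, hGinv]
end

section
/- Let (V, ρ) be a complex representation of G and let s : V → V be a bijective conjugate-linear σ_G-equivariant map with s ∘ s = id_V or s ∘ s = −id_V. Suppose the only ℂ-subspaces of V invariant under ρ(g) for all g ∈ G and under s are 0 and V. Then for every ℂ-subspace W with 0 ≠ W ≠ V that is invariant under ρ(g) for all g ∈ G, the image s(W) is a ℂ-subspace invariant under ρ(g) for all g ∈ G, and V is the internal direct sum of W and s(W): W ∩ s(W) = 0 and W + s(W) = V. (This is the structural step showing that an irreducible Real or Quaternionic representation whose underlying complex representation is reducible splits as W ⊕ s(W).) -/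
/-- Let `(V, ρ)` be a complex representation of `G` and `s : V → V` a
bijective conjugate-linear `σG`-equivariant map with `s ∘ s = id` or `s ∘ s = -id`.
Suppose the only `ℂ`-subspaces of `V` invariant under all `ρ g` and under `s` are `0` and
`V`.  Then for every proper nonzero `ℂ`-subspace `W` invariant under all `ρ g`, the image
`s '' W` is a `ℂ`-subspace invariant under all `ρ g`, and `V` is the internal direct sum of
`W` and `s '' W`.  (This is the structural step showing that an irreducible Real or
Quaternionic representation whose underlying complex representation is reducible splits as
`W ⊕ s(W)`.) -/
theorem real_or_quaternionic_irreducible_splits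
    {G : Type*} [Group G] (σG : G →* G) (hσ : ∀ g, σG (σG g) = g)
    {V : Type*} [AddCommGroup V] [Module ℂ V]
    (ρ : Representation ℂ G V)
    (s : V → V) (hbij : Function.Bijective s)
    (hadds : ∀ u v : V, s (u + v) = s u + s v)
    (hconjs : ∀ (c : ℂ) (v : V), s (c • v) = (starRingEnd ℂ) c • s v)
    (hequivs : ∀ (g : G) (v : V), s (ρ g v) = ρ (σG g) (s v))
    (hsq : (∀ v : V, s (s v) = v) ∨ (∀ v : V, s (s v) = -v))
    (hirr : ∀ W : Submodule ℂ V,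
      (∀ (g : G), ∀ v ∈ W, ρ g v ∈ W) → (∀ v ∈ W, s v ∈ W) → W = ⊥ ∨ W = ⊤)
    (W : Submodule ℂ V) (hW0 : W ≠ ⊥) (hWV : W ≠ ⊤)
    (hWinv : ∀ (g : G), ∀ v ∈ W, ρ g v ∈ W) :
    ∃ W' : Submodule ℂ V,
      (W' : Set V) = s '' (W : Set V) ∧
      (∀ (g : G), ∀ v ∈ W', ρ g v ∈ W') ∧
      W ⊓ W' = ⊥ ∧ W ⊔ W' = ⊤ := by
  have hss : ∀ v ∈ W, s (s v) ∈ W := by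
    intro v hv
    rcases hsq with h | h
    · rw [h]; exact hv
    · rw [h]; exact W.neg_mem hv
  let W' : Submodule ℂ V :=
    { carrier := s '' (W : Set V)
      add_mem' := by
        rintro _ _ ⟨a, ha, rfl⟩ ⟨b, hb, rfl⟩
        exact ⟨a + b, W.add_mem ha hb, hadds a b⟩
      zero_mem' := ⟨0, W.zero_mem, by simpa using hconjs 0 0⟩
      smul_mem' := by
        rintro c _ ⟨a, ha, rfl⟩
        exact ⟨(starRingEnd ℂ) c • a, W.smul_mem _ ha, by rw [hconjs, Complex.conj_conj]⟩ }
  have hmem : ∀ v, v ∈ W' ↔ ∃ w, w ∈ W ∧ s w = v := fun v => Iff.rfl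
  have hW'inv : ∀ (g : G), ∀ v ∈ W', ρ g v ∈ W' := by
    intro g v hv
    obtain ⟨w, hw, rfl⟩ := (hmem v).1 hv
    exact (hmem _).2 ⟨ρ (σG g) w, hWinv _ _ hw, by rw [hequivs, hσ]⟩
  refine ⟨W', rfl, hW'inv, ?_, ?_⟩
  · have hs : ∀ v ∈ W ⊓ W', s v ∈ W ⊓ W' := by
      rintro v ⟨h1, h2⟩
      obtain ⟨w, hw, rfl⟩ := (hmem v).1 h2
      exact ⟨hss w hw, (hmem _).2 ⟨_, h1, rfl⟩⟩
    rcases hirr (W ⊓ W') (fun g v hv => ⟨hWinv g v hv.1, hW'inv g v hv.2⟩) hs with h | h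
    · exact h
    · exact absurd (top_le_iff.1 (h.symm.le.trans inf_le_left)) hWV
  · have hg : ∀ (g : G), ∀ v ∈ W ⊔ W', ρ g v ∈ W ⊔ W' := by
      intro g v hv
      obtain ⟨a, ha, b, hb, rfl⟩ := Submodule.mem_sup.1 hv
      rw [map_add]
      exact Submodule.add_mem_sup (hWinv g a ha) (hW'inv g b hb)
    have hs : ∀ v ∈ W ⊔ W', s v ∈ W ⊔ W' := by
      intro v hv
      obtain ⟨a, ha, b, hb, rfl⟩ := Submodule.mem_sup.1 hv
      obtain ⟨w, hw, rfl⟩ := (hmem b).1 hb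
      rw [hadds, add_comm]
      exact Submodule.add_mem_sup (hss w hw) ((hmem _).2 ⟨a, ha, rfl⟩)
    rcases hirr (W ⊔ W') hg hs with h | h
    · exact absurd (le_bot_iff.1 (le_sup_left.trans h.le)) hW0
    · exact h
end
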